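/- For every ε > 0, if the revealing probabilities are chosen as p_t = min((1+ε)·((a+b)/b)·κ*(a,b)/t, 1) for all t ≥ 1, then lim_{t→∞} t·E_t = (1+ε)·κ*(a,b); in particular, inf over all sequences {p_t} of limsup_{t→∞} t·E_t ≤ κ*(a,b). -/

import Mathlib

open MeasureTheory ProbabilityTheory Filter Asymptotics
open scoped ENNReal NNReal

noncomputable section

/-- The constant `κ*(a,b)` from the paper. -/
def kappaStar (a b : ℝ) : ℝ :=
  1 / (1 + (a / b - 1) / Real.log (a / b) *
      (Real.log ((a / b - 1) / Real.log (a / b)) - 1))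

/-- The signal distribution: `signalProb a b i x = P(X_t = x | θ = i)`,
equal to `a/(a+b)` if `x = i` and `b/(a+b)` otherwise. -/
def signalProb (a b : ℝ) (i x : ℕ) : ℝ :=
  if x = i then a / (a + b) else b / (a + b)

/-- The D-likelihood `D_i^t = Q_i^t(Z_1,…,Z_{t-1},X_t)`: the conditional probability, given
`θ = i`, of observing the actions `Z_1,…,Z_{t-1}` and private signal `X_t` that actually
occurred at the sample point `ω`. -/
def Dlike {Ω : Type*} [MeasurableSpace Ω] (μ : Measure Ω) (θ : Ω → ℕ)
    (X Z : ℕ → Ω → ℕ) (t : ℕ) (i : ℕ) (ω : Ω) : ℝ :=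
  (μ {ω' | θ ω' = i ∧ (∀ s ∈ Finset.Icc 1 (t - 1), Z s ω' = Z s ω) ∧ X t ω' = X t ω}).toReal
    / (μ {ω' | θ ω' = i}).toReal

/-- The maximum a posteriori estimate of `θ` given `(Z_1,…,Z_{t-1},X_t)`, with ties broken
by following the private signal `X_t`.  (The prior on `θ` is uniform, so comparing the
posteriors amounts to comparing `D_1^t` and `D_2^t`.) -/
def mapEst {Ω : Type*} [MeasurableSpace Ω] (μ : Measure Ω) (θ : Ω → ℕ)
    (X Z : ℕ → Ω → ℕ) (t : ℕ) (ω : Ω) : ℕ :=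
  if Dlike μ θ X Z t 2 ω < Dlike μ θ X Z t 1 ω then 1
  else if Dlike μ θ X Z t 1 ω < Dlike μ θ X Z t 2 ω then 2
  else X t ω

/-- The L-likelihood `L_i^t = P_i(Z_1 = z_1, …, Z_t = z_t)` evaluated at the observed
actions. -/
def Llike {Ω : Type*} [MeasurableSpace Ω] (μ : Measure Ω) (θ : Ω → ℕ)
    (Z : ℕ → Ω → ℕ) (t : ℕ) (i : ℕ) (ω : Ω) : ℝ :=
  (μ {ω' | θ ω' = i ∧ ∀ s ∈ Finset.Icc 1 t, Z s ω' = Z s ω}).toReal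
    / (μ {ω' | θ ω' = i}).toReal

/-- The likelihood ratio `R_t = L_1^t / L_2^t` (with `R_0 = 1`). -/
def LR {Ω : Type*} [MeasurableSpace Ω] (μ : Measure Ω) (θ : Ω → ℕ)
    (Z : ℕ → Ω → ℕ) (t : ℕ) (ω : Ω) : ℝ :=
  Llike μ θ Z t 1 ω / Llike μ θ Z t 2 ω

/-- The sequential decision making model with Bayesians and revealers.
`θ` is the state of the world, uniform on `{1,2}`; given `θ`, the signals `X_t` are i.i.d.
with `P(X_t = θ | θ) = a/(a+b)`, the revealing indicators `I_t` are independent Bernoulli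
with `E[I_t] = p_t`, independent of everything else (this is the content of `joint`), and
the actions are `Z_t = X_t` if `I_t = 1` and `Z_t = MAP(Z_1,…,Z_{t-1},X_t)` if `I_t = 0`
(field `dynamics`).  Players are indexed by `t ≥ 1`; `Z 0` is set to the constant `1` for
definiteness. -/
structure IsCascade (a b : ℝ) (p : ℕ → ℝ) {Ω : Type*} [MeasurableSpace Ω]
    (μ : Measure Ω) (θ : Ω → ℕ) (X I Z : ℕ → Ω → ℕ) : Prop where
  prob : IsProbabilityMeasure μ
  theta_meas : Measurable θ
  X_meas : ∀ t, Measurable (X t)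
  I_meas : ∀ t, Measurable (I t)
  Z_meas : ∀ t, Measurable (Z t)
  p_mem : ∀ t : ℕ, 1 ≤ t → p t ∈ Set.Icc (0 : ℝ) 1
  theta_range : ∀ ω, θ ω = 1 ∨ θ ω = 2
  X_range : ∀ t ω, X t ω = 1 ∨ X t ω = 2
  I_range : ∀ t ω, I t ω = 0 ∨ I t ω = 1
  Z_zero : ∀ ω, Z 0 ω = 1
  joint : ∀ i : ℕ, i = 1 ∨ i = 2 → ∀ s : Finset ℕ, (∀ t ∈ s, 1 ≤ t) →
    ∀ x c : ℕ → ℕ, (∀ t, x t = 1 ∨ x t = 2) → (∀ t, c t = 0 ∨ c t = 1) →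
    (μ {ω | θ ω = i ∧ ∀ t ∈ s, X t ω = x t ∧ I t ω = c t}).toReal
      = 1 / 2 * ∏ t ∈ s, signalProb a b i (x t) * (if c t = 1 then p t else 1 - p t)
  dynamics : ∀ t : ℕ, 1 ≤ t → ∀ ω,
    Z t ω = if I t ω = 1 then X t ω else mapEst μ θ X Z t ω

/-- The error probability `E_t = P(Z_t ≠ θ)`. -/
def errProb {Ω : Type*} [MeasurableSpace Ω] (μ : Measure Ω) (θ : Ω → ℕ)
    (Z : ℕ → Ω → ℕ) (t : ℕ) : ℝ :=
  (μ {ω | Z t ω ≠ θ ω}).toReal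

/-- The probability that the MAP estimator is wrong at time `t`:
`P(MAP(Z_1,…,Z_{t-1},X_t) ≠ θ)`. -/
def mapErr {Ω : Type*} [MeasurableSpace Ω] (μ : Measure Ω) (θ : Ω → ℕ)
    (X Z : ℕ → Ω → ℕ) (t : ℕ) : ℝ :=
  (μ {ω | mapEst μ θ X Z t ω ≠ θ ω}).toReal

/-- Lyapunov function. -/
def Vf (η x y : ℝ) : ℝ := min (x ^ (1 - η) * y ^ η) (y ^ (1 - η) * x ^ η)

theorem Vf_comm (η x y : ℝ) : Vf η x y = Vf η y x := min_comm _ _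

theorem Vf_nonneg (η : ℝ) {x y : ℝ} (hx : 0 ≤ x) (hy : 0 ≤ y) : 0 ≤ Vf η x y := by
  unfold Vf; positivity

theorem Vf_eq {η x y : ℝ} (h1 : 1/2 ≤ η) (h2 : η < 1) (hy : 0 ≤ y) (hyx : y ≤ x) :
    Vf η x y = x ^ (1 - η) * y ^ η := by
  have hx : 0 ≤ x := hy.trans hyx
  apply min_eq_left
  have e : ∀ u : ℝ, 0 ≤ u → u ^ η = u ^ (1 - η) * u ^ (2 * η - 1) := by
    intro u hu
    rw [← Real.rpow_add_of_nonneg hu (by linarith) (by linarith)]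
    congr 1; ring
  rw [e y hy, e x hx]
  have : y ^ (2 * η - 1) ≤ x ^ (2 * η - 1) := Real.rpow_le_rpow hy hyx (by linarith)
  have h3 : 0 ≤ y ^ (1 - η) := by positivity
  have h4 : 0 ≤ x ^ (1 - η) := by positivity
  nlinarith [mul_le_mul_of_nonneg_left this (mul_nonneg h3 h4)]

theorem Vf_lower {η x y r : ℝ} (h1 : 1/2 ≤ η) (h2 : η < 1) (hx : 0 ≤ x) (hr : 1 ≤ r)
    (h : x ≤ r * y) : x ≤ r * Vf η x y := by
  have hr0 : 0 < r := by linarith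
  have hy : 0 ≤ y := by
    by_contra hy
    nlinarith
  have aux : ∀ s : ℝ, 0 < s → s < 1 → x ≤ r * (x ^ (1 - s) * y ^ s) := by
    intro s hs0 hs1
    calc x = x ^ (1 - s) * x ^ s := by
          rw [← Real.rpow_add_of_nonneg hx (by linarith) (by linarith)]; simp
      _ ≤ x ^ (1 - s) * (r * y) ^ s := by gcongr
      _ = r ^ s * (x ^ (1 - s) * y ^ s) := by rw [Real.mul_rpow hr0.le hy]; ring
      _ ≤ r * (x ^ (1 - s) * y ^ s) := by
          gcongr
          calc r ^ s ≤ r ^ (1:ℝ) := Real.rpow_le_rpow_of_exponent_le hr hs1.le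
            _ = r := Real.rpow_one r
  unfold Vf
  rcases min_choice (x ^ (1 - η) * y ^ η) (y ^ (1 - η) * x ^ η) with h' | h' <;> rw [h']
  · exact aux η (by linarith) h2
  · have := aux (1 - η) (by linarith) (by linarith)
    rw [sub_sub_cancel] at this
    rwa [mul_comm (y ^ (1 - η))]

theorem Vf_scale_le {η x y c d : ℝ} (h1 : 1/2 ≤ η) (h2 : η < 1) (hy : 0 ≤ y) (hyx : y ≤ x)
    (hc : 0 ≤ c) (hd : 0 ≤ d) :
    Vf η (x * c) (y * d) ≤ (c ^ (1 - η) * d ^ η) * Vf η x y := by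
  have hx : 0 ≤ x := hy.trans hyx
  rw [Vf_eq h1 h2 hy hyx]
  refine (min_le_left _ _).trans (le_of_eq ?_)
  rw [Real.mul_rpow hx hc, Real.mul_rpow hy hd]
  ring

theorem Vf_outer {a b η x y p : ℝ} (hb : 0 < b) (hab : b < a) (h1 : 1/2 ≤ η) (h2 : η < 1)
    (hy : 0 ≤ y) (hyx : y ≤ x) (hp0 : 0 ≤ p) (hp1 : p ≤ 1) :
    Vf η (x * (1 - p * (b / (a+b)))) (y * (1 - p * (a / (a+b)))) +
    Vf η (x * (p * (b / (a+b)))) (y * (p * (a / (a+b)))) ≤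
    (1 - p * (b / (a+b)) * (1 + η * (a/b - 1) - (a/b) ^ η)) * Vf η x y := by
  have ha : 0 < a := by linarith
  have hx : 0 ≤ x := hy.trans hyx
  have ha1 : a / (a+b) ≤ 1 := by rw [div_le_one (by linarith)]; linarith
  have hb1 : b / (a+b) ≤ 1 := by rw [div_le_one (by linarith)]; linarith
  have ha0 : 0 < a / (a+b) := by positivity
  have hb0 : 0 < b / (a+b) := by positivity
  have hba : a / (a+b) = a / b * (b / (a+b)) := by field_simp
  have hc : 0 ≤ 1 - p * (b / (a+b)) := by nlinarith
  have hd : 0 ≤ 1 - p * (a / (a+b)) := by nlinarith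
  have k1 := Vf_scale_le h1 h2 hy hyx hc hd
  have k2 := Vf_scale_le h1 h2 hy hyx (mul_nonneg hp0 hb0.le) (mul_nonneg hp0 ha0.le)
  have hV := Vf_nonneg η hx hy
  have m1 := Real.geom_mean_le_arith_mean2_weighted (w₁ := 1 - η) (w₂ := η) (by linarith)
    (by linarith) hc hd (by ring)
  have m2 : (p * (b / (a+b))) ^ (1 - η) * (p * (a / (a+b))) ^ η
      = p * (b / (a+b)) * (a/b) ^ η := by
    have hpb : 0 ≤ p * (b / (a+b)) := by positivity
    have : p * (a / (a+b)) = a / b * (p * (b / (a+b))) := by rw [hba]; ring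
    rw [this, Real.mul_rpow (by positivity) hpb, mul_left_comm,
      ← Real.rpow_add_of_nonneg hpb (by linarith) (by linarith)]
    simp; ring
  rw [m2] at k2
  refine (add_le_add k1 k2).trans ?_
  rw [← add_mul]
  apply mul_le_mul_of_nonneg_right _ hV
  have : (1 - η) * (1 - p * (b / (a + b))) + η * (1 - p * (a / (a + b)))
      = 1 - p * (b / (a+b)) * (1 + η * (a/b - 1)) := by
    rw [hba]; ring
  linarith

theorem Vf_mid {a b η x y : ℝ} (hb : 0 < b) (hab : b < a) (h1 : 1/2 ≤ η) (h2 : η < 1)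
    (hy : 0 ≤ y) (hyx : y ≤ x) :
    Vf η (x * (a / (a+b))) (y * (b / (a+b))) + Vf η (x * (b / (a+b))) (y * (a / (a+b))) ≤
    (((a/b) ^ (1 - η) + (a/b) ^ η) * (b / (a+b))) * Vf η x y := by
  have ha : 0 < a := by linarith
  have ha0 : 0 < a / (a+b) := by positivity
  have hb0 : 0 < b / (a+b) := by positivity
  have hba : a / (a+b) = a / b * (b / (a+b)) := by field_simp
  have k1 := Vf_scale_le h1 h2 hy hyx ha0.le hb0.le
  have k2 := Vf_scale_le h1 h2 hy hyx hb0.le ha0.le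
  have hr : (b / (a+b)) ^ (1 - η) * (b / (a+b)) ^ η = b / (a+b) := by
    rw [← Real.rpow_add_of_nonneg hb0.le (by linarith) (by linarith)]
    simp
  have m1 : (a / (a+b)) ^ (1 - η) * (b / (a+b)) ^ η = (a/b) ^ (1 - η) * (b / (a+b)) := by
    rw [hba, Real.mul_rpow (by positivity) hb0.le, mul_assoc, hr]
  have m2 : (b / (a+b)) ^ (1 - η) * (a / (a+b)) ^ η = (a/b) ^ η * (b / (a+b)) := by
    rw [hba, Real.mul_rpow (by positivity) hb0.le, mul_left_comm, hr]
  rw [m1] at k1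
  rw [m2] at k2
  linarith

theorem exists_eta {a b : ℝ} (hb : 0 < b) (hab : b < a) :
    ∃ η : ℝ, 1/2 ≤ η ∧ η < 1 ∧ 0 < 1 + η * (a/b - 1) - (a/b) ^ η ∧
      kappaStar a b = 1 / (1 + η * (a/b - 1) - (a/b) ^ η) ∧
      ((a/b) ^ (1 - η) + (a/b) ^ η) * (b / (a+b)) < 1 := by
  have hρ : 1 < a / b := by rwa [one_lt_div hb]
  have hba : b / (a+b) = 1 / (1 + a/b) := by field_simp; ring
  rw [hba]
  unfold kappaStar
  generalize a / b = r at hρ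
  have hr0 : 0 < r := by linarith
  have hl : 0 < Real.log r := Real.log_pos hρ
  set x := (r - 1) / Real.log r with hx
  have hx1 : 1 < x := by
    rw [hx, one_lt_div hl]
    exact Real.log_lt_sub_one_of_pos hr0 hρ.ne'
  have hx0 : 0 < x := by linarith
  have hxr : x < r := by
    rw [hx, div_lt_iff₀ hl]
    have := Real.log_lt_sub_one_of_pos (inv_pos.2 hr0) (by simpa using hρ.ne')
    rw [Real.log_inv] at this
    have h3 : r * r⁻¹ = 1 := mul_inv_cancel₀ hr0.ne'
    nlinarith
  have hlx : Real.log r / 2 ≤ Real.log x := by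
    rw [Real.le_log_iff_exp_le hx0, hx, le_div_iff₀ hl]
    have h := Real.self_le_sinh_iff.2 (show 0 ≤ Real.log r / 2 by positivity)
    rw [Real.sinh_eq] at h
    have e1 : Real.exp (Real.log r / 2) * Real.exp (Real.log r / 2) = r := by
      rw [← Real.exp_add, add_halves, Real.exp_log hr0]
    have e2 : Real.exp (Real.log r / 2) * Real.exp (-(Real.log r / 2)) = 1 := by
      rw [← Real.exp_add]; simp
    have e3 := Real.exp_pos (Real.log r / 2)
    nlinarith [mul_le_mul_of_nonneg_left h e3.le]
  have hpow : r ^ (Real.log x / Real.log r) = x := by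
    rw [Real.rpow_def_of_pos hr0, mul_div_cancel₀ _ hl.ne', Real.exp_log hx0]
  have hf : 1 + Real.log x / Real.log r * (r - 1) - x = 1 + x * (Real.log x - 1) := by
    rw [hx]; field_simp; ring
  refine ⟨Real.log x / Real.log r, ?_, ?_, ?_, ?_, ?_⟩
  · rw [le_div_iff₀ hl]; linarith
  · rw [div_lt_one hl]; exact Real.log_lt_log hx0 hxr
  · rw [hpow, hf]
    have := Real.log_lt_sub_one_of_pos (inv_pos.2 hx0) (by simpa using hx1.ne')
    rw [Real.log_inv] at this
    have h3 : x * x⁻¹ = 1 := mul_inv_cancel₀ hx0.ne'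
    nlinarith
  · rw [hpow, hf]
  · rw [Real.rpow_sub hr0, Real.rpow_one, hpow, mul_one_div, div_lt_one (by linarith)]
    rw [div_add' _ _ _ hx0.ne', div_lt_iff₀ hx0]
    nlinarith

theorem decay_aux {S : ℕ → ℝ} (hS : ∀ n, 0 ≤ S n) {δ : ℝ} (hδ : 0 < δ)
    (h : ∀ᶠ n : ℕ in atTop, S (n+1) ≤ (1 - (1 + δ) / ((n:ℝ) + 1)) * S n) :
    Tendsto (fun n : ℕ => ((n:ℝ) + 1) * S n) atTop (nhds 0) := by
  obtain ⟨N, hN⟩ := eventually_atTop.1 h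
  set M := max N 1 with hM
  have hM1 : 1 ≤ M := le_max_right _ _
  have key : ∀ n, M ≤ n → S n * (n:ℝ) ^ (1 + δ) ≤ S M * (M:ℝ) ^ (1 + δ) := by
    intro n hn
    induction n, hn using Nat.le_induction with
    | base => exact le_rfl
    | succ n hn ih =>
      refine le_trans ?_ ih
      have hn0 : (0:ℝ) ≤ n := Nat.cast_nonneg n
      have hn1 : (0:ℝ) < (n:ℝ) + 1 := by positivity
      have hb : 1 - (1 + δ) / ((n:ℝ) + 1) ≤ ((n:ℝ) / ((n:ℝ) + 1)) ^ (1 + δ) := by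
        have := one_add_mul_self_le_rpow_one_add (s := -(1 / ((n:ℝ) + 1)))
          (by rw [neg_le_neg_iff, div_le_one hn1]; linarith) (p := 1 + δ) (by linarith)
        have e : 1 + -(1 / ((n:ℝ) + 1)) = (n:ℝ) / ((n:ℝ) + 1) := by field_simp; ring
        rw [e] at this
        refine le_trans (le_of_eq ?_) this
        ring
      have h1 := hN n (le_trans (le_max_left _ _) hn)
      have h2 : S (n+1) ≤ ((n:ℝ) / ((n:ℝ) + 1)) ^ (1 + δ) * S n :=
        h1.trans (mul_le_mul_of_nonneg_right hb (hS n))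
      push_cast
      calc S (n+1) * ((n:ℝ) + 1) ^ (1 + δ)
          ≤ (((n:ℝ) / ((n:ℝ) + 1)) ^ (1 + δ) * S n) * ((n:ℝ) + 1) ^ (1 + δ) := by gcongr
        _ = S n * (n:ℝ) ^ (1 + δ) := by
          rw [Real.div_rpow hn0 hn1.le]
          have : ((n:ℝ) + 1) ^ (1 + δ) ≠ 0 := by positivity
          field_simp
  have lim : Tendsto (fun n : ℕ => 2 * (S M * (M:ℝ) ^ (1 + δ)) * (n:ℝ) ^ (-δ)) atTop (nhds 0) := by
    have := ((tendsto_rpow_neg_atTop hδ).comp tendsto_natCast_atTop_atTop).const_mul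
      (2 * (S M * (M:ℝ) ^ (1 + δ)))
    simpa using this
  refine squeeze_zero' (Eventually.of_forall fun n => by have := hS n; positivity) ?_ lim
  filter_upwards [eventually_ge_atTop M] with n hn
  have hn1 : (1:ℝ) ≤ n := by exact_mod_cast hM1.trans hn
  have hn0 : (0:ℝ) < n := by linarith
  have k := key n hn
  have e : (n:ℝ) ^ (1 + δ) * (n:ℝ) ^ (-δ) = n := by
    rw [← Real.rpow_add hn0]; simp
  have k2 := mul_le_mul_of_nonneg_right k (show 0 ≤ (n:ℝ) ^ (-δ) by positivity)
  rw [mul_assoc, e] at k2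
  nlinarith [hS n]

/-- Sum of `F` over all continuations of length `n` of the history `z` of length `t`. -/
def hsum (F : ℕ → (ℕ → ℕ) → ℝ) : ℕ → ℕ → (ℕ → ℕ) → ℝ
  | 0, t, z => F t z
  | n + 1, t, z => hsum F n (t+1) (Function.update z (t+1) 1)
      + hsum F n (t+1) (Function.update z (t+1) 2)

theorem hsum_nonneg {F : ℕ → (ℕ → ℕ) → ℝ} (hF : ∀ t z, 0 ≤ F t z) (n t : ℕ) (z : ℕ → ℕ) :
    0 ≤ hsum F n t z := by
  induction n generalizing t z with
  | zero => exact hF t z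
  | succ n ih => exact add_nonneg (ih _ _) (ih _ _)

theorem hsum_contract {F : ℕ → (ℕ → ℕ) → ℝ} {q : ℕ → ℝ}
    (h : ∀ t z, F (t+1) (Function.update z (t+1) 1) + F (t+1) (Function.update z (t+1) 2)
      ≤ q (t+1) * F t z) (n t : ℕ) (z : ℕ → ℕ) :
    hsum F (n+1) t z ≤ q (t+n+1) * hsum F n t z := by
  induction n generalizing t z with
  | zero => exact h t z
  | succ n ih =>
    have e : t + 1 + n + 1 = t + (n + 1) + 1 := by omega
    have h1 := ih (t+1) (Function.update z (t+1) 1)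
    have h2 := ih (t+1) (Function.update z (t+1) 2)
    rw [e] at h1 h2
    rw [hsum]
    refine (add_le_add h1 h2).trans (le_of_eq ?_)
    rw [← mul_add]
    rfl

/-- Likelihood (joint with `θ = i`) of the action history `z` up to time `t`. -/
def hlike {Ω : Type*} [MeasurableSpace Ω] (μ : Measure Ω) (θ : Ω → ℕ)
    (Z : ℕ → Ω → ℕ) (t i : ℕ) (z : ℕ → ℕ) : ℝ :=
  (μ {ω | θ ω = i ∧ ∀ s ∈ Finset.Icc 1 t, Z s ω = z s}).toReal

theorem mapEst_congr {Ω : Type*} [MeasurableSpace Ω] (μ : Measure Ω) (θ : Ω → ℕ)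
    (X Z : ℕ → Ω → ℕ) (t : ℕ) (ω ω' : Ω)
    (h : ∀ s ∈ Finset.Icc 1 (t - 1), Z s ω = Z s ω') (hX : X t ω = X t ω') :
    mapEst μ θ X Z t ω = mapEst μ θ X Z t ω' := by
  have hD : ∀ i, Dlike μ θ X Z t i ω = Dlike μ θ X Z t i ω' := by
    intro i
    unfold Dlike
    have : {w | θ w = i ∧ (∀ s ∈ Finset.Icc 1 (t - 1), Z s w = Z s ω) ∧ X t w = X t ω}
      = {w | θ w = i ∧ (∀ s ∈ Finset.Icc 1 (t - 1), Z s w = Z s ω') ∧ X t w = X t ω'} := by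
      ext w
      simp only [Set.mem_ofPred_eq, hX]
      constructor
      · rintro ⟨h1, h2, h3⟩
        exact ⟨h1, fun s hs => (h2 s hs).trans (h s hs), h3⟩
      · rintro ⟨h1, h2, h3⟩
        exact ⟨h1, fun s hs => (h2 s hs).trans (h s hs).symm, h3⟩
    rw [this]
  unfold mapEst
  rw [hD, hD, hX]

section cascade

variable {a b : ℝ} {p : ℕ → ℝ} {Ω : Type*} [MeasurableSpace Ω]
  {μ : Measure Ω} {θ : Ω → ℕ} {X I Z : ℕ → Ω → ℕ}

theorem cascade_determined (hC : IsCascade a b p μ θ X I Z) (t : ℕ) (ω ω' : Ω)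
    (h : ∀ s ∈ Finset.Icc 1 t, X s ω = X s ω' ∧ I s ω = I s ω') :
    ∀ s ∈ Finset.Icc 1 t, Z s ω = Z s ω' := by
  intro s
  induction s using Nat.strong_induction_on with
  | _ s ih =>
    intro hs
    have hs' := Finset.mem_Icc.1 hs
    rw [hC.dynamics s hs'.1, hC.dynamics s hs'.1, (h s hs).1, (h s hs).2]
    rw [mapEst_congr μ θ X Z s ω ω' _ (h s hs).1]
    intro r hr
    have hr' := Finset.mem_Icc.1 hr
    exact ih r (by omega) (Finset.mem_Icc.2 ⟨hr'.1, by omega⟩)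

theorem cascade_factor (hC : IsCascade a b p μ θ X I Z) (ha : 0 < a) (hb : 0 < b) (t i : ℕ)
    (hi : i = 1 ∨ i = 2)
    (z : ℕ → ℕ) (x c : ℕ) (hx : x = 1 ∨ x = 2) (hc : c = 0 ∨ c = 1) :
    (μ {ω | θ ω = i ∧ (∀ s ∈ Finset.Icc 1 t, Z s ω = z s) ∧ X (t+1) ω = x ∧ I (t+1) ω = c}).toReal
      = hlike μ θ Z t i z *
        (signalProb a b i x * (if c = 1 then p (t+1) else 1 - p (t+1))) := by
  have := hC.prob
  have hpm := hC.p_mem (t+1) (by omega)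
  set k : ℝ := signalProb a b i x * (if c = 1 then p (t+1) else 1 - p (t+1)) with hk
  have hk0 : 0 ≤ k := by
    apply mul_nonneg
    · unfold signalProb; split_ifs <;> positivity
    · split_ifs
      · exact hpm.1
      · linarith [hpm.2]
  let T : Ω → (Finset.Icc 1 t → ℕ × ℕ) := fun ω s => (X s ω, I s ω)
  have hT : Measurable T := by
    apply measurable_pi_lambda
    intro s
    exact (hC.X_meas s).prodMk (hC.I_meas s)
  have hm1 : MeasurableSet {ω | θ ω = i} := hC.theta_meas (measurableSet_singleton i)
  have hm2 : MeasurableSet {ω | X (t+1) ω = x ∧ I (t+1) ω = c} :=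
    (hC.X_meas (t+1) (measurableSet_singleton x)).inter (hC.I_meas (t+1) (measurableSet_singleton c))
  have key : (μ.restrict ({ω | θ ω = i} ∩ {ω | X (t+1) ω = x ∧ I (t+1) ω = c})).map T
      = ENNReal.ofReal k • (μ.restrict {ω | θ ω = i}).map T := by
    refine Measure.ext_of_singleton fun y => ?_
    rw [Measure.smul_apply, Measure.map_apply hT (measurableSet_singleton _),
      Measure.map_apply hT (measurableSet_singleton _),
      Measure.restrict_apply (hT (measurableSet_singleton _)),
      Measure.restrict_apply (hT (measurableSet_singleton _)), smul_eq_mul]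
    by_cases hy : ∀ s, ((y s).1 = 1 ∨ (y s).1 = 2) ∧ ((y s).2 = 0 ∨ (y s).2 = 1)
    · let x' : ℕ → ℕ := fun s => if h : s ∈ Finset.Icc 1 t then (y ⟨s, h⟩).1 else x
      let c' : ℕ → ℕ := fun s => if h : s ∈ Finset.Icc 1 t then (y ⟨s, h⟩).2 else c
      have hx' : ∀ s, x' s = 1 ∨ x' s = 2 := by
        intro s
        simp only [x']
        split_ifs with h
        · exact (hy _).1
        · exact hx
      have hc' : ∀ s, c' s = 0 ∨ c' s = 1 := by
        intro s
        simp only [c']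
        split_ifs with h
        · exact (hy _).2
        · exact hc
      have hxt : x' (t+1) = x := by simp [x']
      have hct : c' (t+1) = c := by simp [c']
      have j1 := hC.joint i hi (Finset.Icc 1 (t+1)) (fun s hs => (Finset.mem_Icc.1 hs).1) x' c' hx' hc'
      have j2 := hC.joint i hi (Finset.Icc 1 t) (fun s hs => (Finset.mem_Icc.1 hs).1) x' c' hx' hc'
      rw [Finset.prod_Icc_succ_top (by omega), ← mul_assoc, ← j2, hxt, hct, ← hk] at j1
      have hTy : ∀ ω, T ω = y ↔ ∀ s ∈ Finset.Icc 1 t, X s ω = x' s ∧ I s ω = c' s := by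
        intro ω
        constructor
        · intro h s hs
          have := congrFun h ⟨s, hs⟩
          simp only [T, x', c', dif_pos hs] at this ⊢
          rw [← this]; simp
        · intro h
          funext ⟨s, hs⟩
          have := h s hs
          simp only [T, x', c', dif_pos hs] at this ⊢
          rw [this.1, this.2]
      have e1 : T ⁻¹' {y} ∩ ({ω | θ ω = i} ∩ {ω | X (t+1) ω = x ∧ I (t+1) ω = c})
          = {ω | θ ω = i ∧ ∀ s ∈ Finset.Icc 1 (t+1), X s ω = x' s ∧ I s ω = c' s} := by
        ext ω
        simp only [Set.mem_inter_iff, Set.mem_preimage, Set.mem_singleton_iff, hTy, Set.mem_ofPred_eq]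
        constructor
        · rintro ⟨h1, h2, h3⟩
          refine ⟨h2, fun s hs => ?_⟩
          by_cases h : s = t + 1
          · subst h; rw [hxt, hct]; exact h3
          · exact h1 s (by simp only [Finset.mem_Icc] at hs ⊢; omega)
        · rintro ⟨h1, h2⟩
          refine ⟨fun s hs => h2 s (by simp only [Finset.mem_Icc] at hs ⊢; omega), h1, ?_⟩
          have := h2 (t+1) (by simp)
          rwa [hxt, hct] at this
      have e2 : T ⁻¹' {y} ∩ {ω | θ ω = i}
          = {ω | θ ω = i ∧ ∀ s ∈ Finset.Icc 1 t, X s ω = x' s ∧ I s ω = c' s} := by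
        ext ω
        simp only [Set.mem_inter_iff, Set.mem_preimage, Set.mem_singleton_iff, hTy, Set.mem_ofPred_eq]
        tauto
      rw [e1, e2]
      rw [← ENNReal.toReal_eq_toReal_iff' (measure_ne_top _ _)
        (ENNReal.mul_ne_top ENNReal.ofReal_ne_top (measure_ne_top _ _)), j1,
        ENNReal.toReal_mul, ENNReal.toReal_ofReal hk0, mul_comm]
    · have e : T ⁻¹' {y} = ∅ := by
        ext ω
        simp only [Set.mem_preimage, Set.mem_singleton_iff, Set.mem_empty_iff_false, iff_false]
        rintro rfl
        exact hy fun s => ⟨hC.X_range _ _, hC.I_range _ _⟩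
      simp [e]
  let B : Set (Finset.Icc 1 t → ℕ × ℕ) := {y | ∃ ω, T ω = y ∧ ∀ s ∈ Finset.Icc 1 t, Z s ω = z s}
  have hB : T ⁻¹' B = {ω | ∀ s ∈ Finset.Icc 1 t, Z s ω = z s} := by
    ext ω
    constructor
    · rintro ⟨ω', h1, h2⟩
      intro s hs
      rw [← h2 s hs]
      refine cascade_determined hC t ω ω' (fun r hr => ?_) s hs
      have := congrFun h1 ⟨r, hr⟩
      simp only [T, Prod.mk.injEq] at this
      exact ⟨this.1.symm, this.2.symm⟩
    · intro h
      exact ⟨ω, rfl, h⟩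
  have hBm : MeasurableSet B := MeasurableSet.of_discrete
  have := congrArg (fun ν => (ν B).toReal) key
  simp only [Measure.smul_apply, smul_eq_mul] at this
  rw [Measure.map_apply hT hBm, Measure.map_apply hT hBm, Measure.restrict_apply (hT hBm),
    Measure.restrict_apply (hT hBm), hB, ENNReal.toReal_mul, ENNReal.toReal_ofReal hk0] at this
  unfold hlike
  have e3 : {ω | θ ω = i ∧ (∀ s ∈ Finset.Icc 1 t, Z s ω = z s) ∧ X (t+1) ω = x ∧ I (t+1) ω = c}
      = {ω | ∀ s ∈ Finset.Icc 1 t, Z s ω = z s} ∩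
        ({ω | θ ω = i} ∩ {ω | X (t+1) ω = x ∧ I (t+1) ω = c}) := by
    ext ω
    simp only [Set.mem_inter_iff, Set.mem_ofPred_eq]
    tauto
  have e4 : {ω | θ ω = i ∧ ∀ s ∈ Finset.Icc 1 t, Z s ω = z s}
      = {ω | ∀ s ∈ Finset.Icc 1 t, Z s ω = z s} ∩ {ω | θ ω = i} := by
    ext ω
    simp only [Set.mem_inter_iff, Set.mem_ofPred_eq]
    tauto
  rw [e3, e4, this, mul_comm]

theorem split_two {α : Type*} [MeasurableSpace α] {ν : Measure α} [IsFiniteMeasure ν]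
    {f : α → ℕ} (hf : Measurable f) {u v : ℕ} (huv : u ≠ v) (hr : ∀ w, f w = u ∨ f w = v)
    (A : Set α) :
    (ν A).toReal = (ν {w | w ∈ A ∧ f w = u}).toReal + (ν {w | w ∈ A ∧ f w = v}).toReal := by
  rw [← measure_inter_add_sdiff A (hf (measurableSet_singleton u)),
    ENNReal.toReal_add (measure_ne_top _ _) (measure_ne_top _ _)]
  congr 3
  ext w
  simp only [Set.mem_sdiff, Set.mem_preimage, Set.mem_singleton_iff, Set.mem_ofPred_eq]
  have := hr w
  constructor
  · rintro ⟨h1, h2⟩; tauto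
  · rintro ⟨h1, h2⟩; exact ⟨h1, by omega⟩

theorem cascade_X (hC : IsCascade a b p μ θ X I Z) (ha : 0 < a) (hb : 0 < b) (t i : ℕ)
    (hi : i = 1 ∨ i = 2) (z : ℕ → ℕ) (x : ℕ) (hx : x = 1 ∨ x = 2) :
    (μ {ω | θ ω = i ∧ (∀ s ∈ Finset.Icc 1 t, Z s ω = z s) ∧ X (t+1) ω = x}).toReal
      = hlike μ θ Z t i z * signalProb a b i x := by
  have := hC.prob
  rw [split_two (hC.I_meas (t+1)) zero_ne_one (hC.I_range (t+1))]
  have h0 := cascade_factor hC ha hb t i hi z x 0 hx (Or.inl rfl)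
  have h1 := cascade_factor hC ha hb t i hi z x 1 hx (Or.inr rfl)
  simp only [Set.mem_ofPred_eq, and_assoc] at *
  rw [h0, h1]
  simp
  ring

theorem cascade_half (hC : IsCascade a b p μ θ X I Z) (i : ℕ) (hi : i = 1 ∨ i = 2) :
    (μ {ω | θ ω = i}).toReal = 1 / 2 := by
  have := hC.joint i hi ∅ (by simp) (fun _ => 1) (fun _ => 0) (by simp) (by simp)
  simpa using this

theorem cascade_D (hC : IsCascade a b p μ θ X I Z) (ha : 0 < a) (hb : 0 < b) (t i : ℕ)
    (hi : i = 1 ∨ i = 2) (z : ℕ → ℕ) (ω : Ω) (hω : ∀ s ∈ Finset.Icc 1 t, Z s ω = z s) :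
    Dlike μ θ X Z (t+1) i ω = 2 * (hlike μ θ Z t i z * signalProb a b i (X (t+1) ω)) := by
  unfold Dlike
  rw [cascade_half hC i hi, ← cascade_X hC ha hb t i hi z _ (hC.X_range (t+1) ω)]
  have : {w | θ w = i ∧ (∀ s ∈ Finset.Icc 1 (t + 1 - 1), Z s w = Z s ω) ∧ X (t+1) w = X (t+1) ω}
     = {w | θ w = i ∧ (∀ s ∈ Finset.Icc 1 t, Z s w = z s) ∧ X (t+1) w = X (t+1) ω} := by
    ext w
    simp only [Set.mem_ofPred_eq, Nat.add_sub_cancel]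
    constructor
    · rintro ⟨h1, h2, h3⟩
      exact ⟨h1, fun s hs => (h2 s hs).trans (hω s hs), h3⟩
    · rintro ⟨h1, h2, h3⟩
      exact ⟨h1, fun s hs => (h2 s hs).trans (hω s hs).symm, h3⟩
  rw [this]
  ring

theorem cascade_map_one (hC : IsCascade a b p μ θ X I Z) (hb : 0 < b) (hab : b < a) (t : ℕ)
    (z : ℕ → ℕ) (h : a * hlike μ θ Z t 2 z < b * hlike μ θ Z t 1 z)
    (ω : Ω) (hω : ∀ s ∈ Finset.Icc 1 t, Z s ω = z s) :
    mapEst μ θ X Z (t+1) ω = 1 := by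
  have ha : 0 < a := by linarith
  have h2 : 0 ≤ hlike μ θ Z t 2 z := ENNReal.toReal_nonneg
  have h1 : 0 ≤ hlike μ θ Z t 1 z := ENNReal.toReal_nonneg
  unfold mapEst
  rw [cascade_D hC ha hb t 1 (Or.inl rfl) z ω hω, cascade_D hC ha hb t 2 (Or.inr rfl) z ω hω]
  rw [if_pos]
  have hs : 0 < a + b := by linarith
  rcases hC.X_range (t+1) ω with hx | hx <;> rw [hx] <;> simp only [signalProb]
  · norm_num
    rw [← mul_div_assoc, ← mul_div_assoc]
    gcongr 1
    nlinarith
  · norm_num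
    rw [← mul_div_assoc, ← mul_div_assoc]
    gcongr 1
    nlinarith

theorem cascade_map_two (hC : IsCascade a b p μ θ X I Z) (hb : 0 < b) (hab : b < a) (t : ℕ)
    (z : ℕ → ℕ) (h : a * hlike μ θ Z t 1 z < b * hlike μ θ Z t 2 z)
    (ω : Ω) (hω : ∀ s ∈ Finset.Icc 1 t, Z s ω = z s) :
    mapEst μ θ X Z (t+1) ω = 2 := by
  have ha : 0 < a := by linarith
  have h2 : 0 ≤ hlike μ θ Z t 2 z := ENNReal.toReal_nonneg
  have h1 : 0 ≤ hlike μ θ Z t 1 z := ENNReal.toReal_nonneg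
  have hs : 0 < a + b := by linarith
  have key : Dlike μ θ X Z (t+1) 1 ω < Dlike μ θ X Z (t+1) 2 ω := by
    rw [cascade_D hC ha hb t 1 (Or.inl rfl) z ω hω, cascade_D hC ha hb t 2 (Or.inr rfl) z ω hω]
    rcases hC.X_range (t+1) ω with hx | hx <;> rw [hx] <;> simp only [signalProb]
    · norm_num
      rw [← mul_div_assoc, ← mul_div_assoc]
      gcongr 1
      nlinarith
    · norm_num
      rw [← mul_div_assoc, ← mul_div_assoc]
      gcongr 1
      nlinarith
  unfold mapEst
  rw [if_neg (not_lt.2 key.le), if_pos key]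

theorem cascade_map_mid (hC : IsCascade a b p μ θ X I Z) (hb : 0 < b) (hab : b < a) (t : ℕ)
    (z : ℕ → ℕ) (h21 : b * hlike μ θ Z t 1 z ≤ a * hlike μ θ Z t 2 z)
    (h12 : b * hlike μ θ Z t 2 z ≤ a * hlike μ θ Z t 1 z)
    (ω : Ω) (hω : ∀ s ∈ Finset.Icc 1 t, Z s ω = z s) :
    mapEst μ θ X Z (t+1) ω = X (t+1) ω := by
  have ha : 0 < a := by linarith
  have hs : 0 < a + b := by linarith
  unfold mapEst
  rw [cascade_D hC ha hb t 1 (Or.inl rfl) z ω hω, cascade_D hC ha hb t 2 (Or.inr rfl) z ω hω]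
  rcases hC.X_range (t+1) ω with hx | hx <;> rw [hx] <;> simp only [signalProb]
  · have : ¬ (hlike μ θ Z t 1 z * (a / (a+b)) < hlike μ θ Z t 2 z * (b / (a+b))) := by
      rw [not_lt, ← mul_div_assoc, ← mul_div_assoc]
      gcongr 1
      linarith
    norm_num
    intro _
    exact not_lt.1 this
  · have : ¬ (hlike μ θ Z t 2 z * (a / (a+b)) < hlike μ θ Z t 1 z * (b / (a+b))) := by
      rw [not_lt, ← mul_div_assoc, ← mul_div_assoc]
      gcongr 1
      linarith
    norm_num
    exact not_lt.1 this

theorem cascade_step (hC : IsCascade a b p μ θ X I Z) (ha : 0 < a) (hb : 0 < b) (t i : ℕ)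
    (hi : i = 1 ∨ i = 2) (z : ℕ → ℕ) (m : ℕ → ℕ)
    (hm : ∀ ω, (∀ s ∈ Finset.Icc 1 t, Z s ω = z s) → mapEst μ θ X Z (t+1) ω = m (X (t+1) ω))
    (k : ℕ) :
    hlike μ θ Z (t+1) i (Function.update z (t+1) k) = hlike μ θ Z t i z *
      (signalProb a b i 1 * ((if 1 = k then p (t+1) else 0) + (if m 1 = k then 1 - p (t+1) else 0))
       + signalProb a b i 2 *
        ((if 2 = k then p (t+1) else 0) + (if m 2 = k then 1 - p (t+1) else 0))) := by
  have := hC.prob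
  have e0 : {ω | θ ω = i ∧ ∀ s ∈ Finset.Icc 1 (t+1), Z s ω = Function.update z (t+1) k s}
      = {ω | θ ω = i ∧ (∀ s ∈ Finset.Icc 1 t, Z s ω = z s) ∧ Z (t+1) ω = k} := by
    ext ω
    simp only [Set.mem_ofPred_eq]
    constructor
    · rintro ⟨h1, h2⟩
      refine ⟨h1, fun s hs => ?_, by simpa using h2 (t+1) (by simp)⟩
      simp only [Finset.mem_Icc] at hs
      have := h2 s (by simp only [Finset.mem_Icc]; omega)
      rwa [Function.update_of_ne (by omega)] at this
    · rintro ⟨h1, h2, h3⟩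
      refine ⟨h1, fun s hs => ?_⟩
      simp only [Finset.mem_Icc] at hs
      by_cases h : s = t+1
      · subst h; simpa using h3
      · rw [Function.update_of_ne h]
        exact h2 s (by simp only [Finset.mem_Icc]; omega)
  have piece : ∀ x c, (x = 1 ∨ x = 2) → (c = 0 ∨ c = 1) →
      (μ {w | w ∈ {w | w ∈ {ω | θ ω = i ∧ (∀ s ∈ Finset.Icc 1 t, Z s ω = z s) ∧ Z (t+1) ω = k}
        ∧ X (t+1) w = x} ∧ I (t+1) w = c}).toReal
      = if (if c = 1 then x else m x) = k then hlike μ θ Z t i z *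
        (signalProb a b i x * (if c = 1 then p (t+1) else 1 - p (t+1))) else 0 := by
    intro x c hx hc
    rw [← cascade_factor hC ha hb t i hi z x c hx hc]
    have hZ : ∀ w, (∀ s ∈ Finset.Icc 1 t, Z s w = z s) → X (t+1) w = x → I (t+1) w = c →
        Z (t+1) w = if c = 1 then x else m x := by
      intro w h1 h2 h3
      rw [hC.dynamics (t+1) (by omega), h2, h3, hm w h1, h2]
    split_ifs with hk
    all_goals first
      | (congr 2
         ext w
         simp only [Set.mem_ofPred_eq]
         constructor
         · tauto
         · rintro ⟨h1, h2, h3, h4⟩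
           refine ⟨⟨⟨h1, h2, ?_⟩, h3⟩, h4⟩
           rw [hZ w h2 h3 h4]
           simpa [hk] using ‹_ = k›)
      | (rw [ENNReal.toReal_eq_zero_iff]
         left
         convert measure_empty (μ := μ)
         ext w
         simp only [Set.mem_ofPred_eq, Set.mem_empty_iff_false, iff_false]
         rintro ⟨⟨⟨h1, h2, h5⟩, h3⟩, h4⟩
         have := hZ w h2 h3 h4
         rw [h5] at this
         simp_all)
  unfold hlike at piece ⊢
  rw [e0, split_two (hC.X_meas (t+1)) (show (1:ℕ) ≠ 2 by norm_num) (hC.X_range (t+1)),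
    split_two (hC.I_meas (t+1)) zero_ne_one (hC.I_range (t+1)) {w | _ ∧ X (t+1) w = 1},
    split_two (hC.I_meas (t+1)) zero_ne_one (hC.I_range (t+1)) {w | _ ∧ X (t+1) w = 2},
    piece 1 0 (by simp) (by simp), piece 1 1 (by simp) (by simp),
    piece 2 0 (by simp) (by simp), piece 2 1 (by simp) (by simp)]
  simp only [zero_ne_one, if_false, if_true]
  split_ifs <;> ring

theorem cascade_Z_range (hC : IsCascade a b p μ θ X I Z) (t : ℕ) (ω : Ω) :
    Z t ω = 1 ∨ Z t ω = 2 := by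
  rcases Nat.eq_zero_or_pos t with rfl | ht
  · exact Or.inl (hC.Z_zero ω)
  · rw [hC.dynamics t ht]
    unfold mapEst
    have := hC.X_range t ω
    split_ifs <;> simp [this]

theorem hlike_congr {t i : ℕ} {z z' : ℕ → ℕ} (h : ∀ s ∈ Finset.Icc 1 t, z s = z' s) :
    hlike μ θ Z t i z = hlike μ θ Z t i z' := by
  unfold hlike
  congr 2
  ext ω
  simp only [Set.mem_ofPred_eq]
  constructor
  · rintro ⟨h1, h2⟩
    exact ⟨h1, fun s hs => (h2 s hs).trans (h s hs)⟩
  · rintro ⟨h1, h2⟩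
    exact ⟨h1, fun s hs => (h2 s hs).trans (h s hs).symm⟩

theorem cascade_bad (hC : IsCascade a b p μ θ X I Z) (hb : 0 < b) (hab : b < a)
    {η : ℝ} (h1 : 1/2 ≤ η) (h2 : η < 1) (i j : ℕ) (n t : ℕ) (z : ℕ → ℕ) :
    (μ {ω | θ ω = i ∧ (∀ s ∈ Finset.Icc 1 t, Z s ω = z s) ∧
      b * hlike μ θ Z (t+n) i (fun s => Z s ω) ≤ a * hlike μ θ Z (t+n) j (fun s => Z s ω)}).toReal
    ≤ (a/b) * hsum (fun t z => Vf η (hlike μ θ Z t i z) (hlike μ θ Z t j z)) n t z := by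
  have := hC.prob
  have ha : 0 < a := by linarith
  have nn : ∀ t i z, 0 ≤ hlike μ θ Z t i z := fun _ _ _ => ENNReal.toReal_nonneg
  induction n generalizing t z with
  | zero =>
    rw [hsum]
    have hc : ∀ ω, (∀ s ∈ Finset.Icc 1 t, Z s ω = z s) → ∀ i,
        hlike μ θ Z t i (fun s => Z s ω) = hlike μ θ Z t i z :=
      fun ω h i => hlike_congr h
    by_cases hz : b * hlike μ θ Z t i z ≤ a * hlike μ θ Z t j z
    · refine le_trans ?_ (Vf_lower h1 h2 (nn t i z) (r := a/b) ?_ ?_)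
      · apply ENNReal.toReal_mono (measure_ne_top _ _)
        apply measure_mono
        rintro ω ⟨h1, h2, -⟩
        exact ⟨h1, h2⟩
      · rw [one_le_div hb]; exact hab.le
      · rw [div_mul_eq_mul_div, le_div_iff₀ hb]; linarith
    · have : {ω | θ ω = i ∧ (∀ s ∈ Finset.Icc 1 t, Z s ω = z s) ∧
          b * hlike μ θ Z (t+0) i (fun s => Z s ω) ≤ a * hlike μ θ Z (t+0) j (fun s => Z s ω)}
          = ∅ := by
        ext ω
        simp only [Set.mem_ofPred_eq, Set.mem_empty_iff_false, iff_false]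
        rintro ⟨h1, h2, h3⟩
        rw [add_zero, hc ω h2, hc ω h2] at h3
        exact hz h3
      rw [this, measure_empty, ENNReal.toReal_zero]
      exact mul_nonneg (by positivity) (Vf_nonneg _ (nn _ _ _) (nn _ _ _))
  | succ n ih =>
    rw [hsum, mul_add, split_two (hC.Z_meas (t+1)) (show (1:ℕ) ≠ 2 by norm_num)
      (cascade_Z_range hC (t+1))]
    have sub : ∀ k, (μ {w | w ∈ {ω | θ ω = i ∧ (∀ s ∈ Finset.Icc 1 t, Z s ω = z s) ∧
      b * hlike μ θ Z (t+(n+1)) i (fun s => Z s ω) ≤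
        a * hlike μ θ Z (t+(n+1)) j (fun s => Z s ω)} ∧ Z (t+1) w = k}).toReal ≤
      (μ {ω | θ ω = i ∧ (∀ s ∈ Finset.Icc 1 (t+1), Z s ω = Function.update z (t+1) k s) ∧
      b * hlike μ θ Z (t+1+n) i (fun s => Z s ω) ≤
        a * hlike μ θ Z (t+1+n) j (fun s => Z s ω)}).toReal := by
      intro k
      apply ENNReal.toReal_mono (measure_ne_top _ _)
      apply measure_mono
      rintro ω ⟨⟨g1, g2, g3⟩, g4⟩
      refine ⟨g1, fun s hs => ?_, ?_⟩
      · simp only [Finset.mem_Icc] at hs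
        by_cases h : s = t+1
        · subst h; simpa using g4
        · rw [Function.update_of_ne h]
          exact g2 s (by simp only [Finset.mem_Icc]; omega)
      · rwa [show t + 1 + n = t + (n+1) by omega]
    exact add_le_add ((sub 1).trans (ih _ _)) ((sub 2).trans (ih _ _))

theorem cascade_contract (hC : IsCascade a b p μ θ X I Z) (hb : 0 < b) (hab : b < a)
    {η : ℝ} (h1 : 1/2 ≤ η) (h2 : η < 1) (t : ℕ) (z : ℕ → ℕ) :
    Vf η (hlike μ θ Z (t+1) 1 (Function.update z (t+1) 1))
        (hlike μ θ Z (t+1) 2 (Function.update z (t+1) 1)) +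
    Vf η (hlike μ θ Z (t+1) 1 (Function.update z (t+1) 2))
        (hlike μ θ Z (t+1) 2 (Function.update z (t+1) 2)) ≤
    max (1 - p (t+1) * (b / (a+b)) * (1 + η * (a/b - 1) - (a/b) ^ η))
      (((a/b) ^ (1 - η) + (a/b) ^ η) * (b / (a+b))) *
      Vf η (hlike μ θ Z t 1 z) (hlike μ θ Z t 2 z) := by
  have ha : 0 < a := by linarith
  have hab' : a / (a+b) = 1 - b / (a+b) := by field_simp; ring
  have hpm := hC.p_mem (t+1) (by omega)
  have n1 : 0 ≤ hlike μ θ Z t 1 z := ENNReal.toReal_nonneg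
  have n2 : 0 ≤ hlike μ θ Z t 2 z := ENNReal.toReal_nonneg
  have hV := Vf_nonneg η n1 n2
  have step := fun m hm i hi k => cascade_step hC ha hb t i hi z m hm k
  by_cases c1 : a * hlike μ θ Z t 2 z < b * hlike μ θ Z t 1 z
  · have hm := cascade_map_one hC hb hab t z c1
    refine le_trans (le_trans (le_of_eq ?_) (Vf_outer hb hab h1 h2 n2 (x := hlike μ θ Z t 1 z)
      (by nlinarith) hpm.1 hpm.2)) (mul_le_mul_of_nonneg_right (le_max_left _ _) hV)
    rw [step (fun _ => 1) hm 1 (Or.inl rfl) 1, step (fun _ => 1) hm 2 (Or.inr rfl) 1,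
      step (fun _ => 1) hm 1 (Or.inl rfl) 2, step (fun _ => 1) hm 2 (Or.inr rfl) 2]
    simp only [signalProb]
    norm_num
    congr 1
    · congr 2
      · rw [hab']; ring
      · rw [hab']; ring
    · congr 2 <;> ring
  by_cases c2 : a * hlike μ θ Z t 1 z < b * hlike μ θ Z t 2 z
  · have hm := cascade_map_two hC hb hab t z c2
    rw [Vf_comm η (hlike μ θ Z t 1 z), Vf_comm η (hlike μ θ Z (t+1) 1 _),
      Vf_comm η (hlike μ θ Z (t+1) 1 _), add_comm]
    rw [Vf_comm] at hV
    refine le_trans (le_trans (le_of_eq ?_) (Vf_outer hb hab h1 h2 n1 (x := hlike μ θ Z t 2 z)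
      (by nlinarith) hpm.1 hpm.2)) (mul_le_mul_of_nonneg_right (le_max_left _ _) hV)
    rw [step (fun _ => 2) hm 1 (Or.inl rfl) 1, step (fun _ => 2) hm 2 (Or.inr rfl) 1,
      step (fun _ => 2) hm 1 (Or.inl rfl) 2, step (fun _ => 2) hm 2 (Or.inr rfl) 2]
    simp only [signalProb]
    norm_num
    congr 1
    · congr 2
      · rw [hab']; ring
      · rw [hab']; ring
    · congr 2 <;> ring
  · have hm := cascade_map_mid hC hb hab t z (not_lt.1 c1) (not_lt.1 c2)
    have e : ∀ i k, (i = 1 ∨ i = 2) → (k = 1 ∨ k = 2) →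
        hlike μ θ Z (t+1) i (Function.update z (t+1) k) = hlike μ θ Z t i z * signalProb a b i k := by
      intro i k hi hk
      rw [step (fun x => x) hm i hi k]
      rcases hk with rfl | rfl <;> simp
    rw [e 1 1 (by simp) (by simp), e 2 1 (by simp) (by simp), e 1 2 (by simp) (by simp),
      e 2 2 (by simp) (by simp)]
    simp only [signalProb]
    norm_num
    refine le_trans ?_ (mul_le_mul_of_nonneg_right (le_max_right _ _) hV)
    rcases le_total (hlike μ θ Z t 2 z) (hlike μ θ Z t 1 z) with h | h
    · exact Vf_mid hb hab h1 h2 n2 h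
    · have := Vf_mid hb hab h1 h2 n1 h
      rw [Vf_comm η (hlike μ θ Z t 1 z * _), Vf_comm η (hlike μ θ Z t 1 z * _),
        Vf_comm η (hlike μ θ Z t 1 z), add_comm]
      exact this

theorem cascade_err (hC : IsCascade a b p μ θ X I Z) (hb : 0 < b) (hab : b < a)
    {η : ℝ} (h1 : 1/2 ≤ η) (h2 : η < 1) (t : ℕ) :
    p (t+1) * (b / (a+b)) ≤ errProb μ θ Z (t+1) ∧
    errProb μ θ Z (t+1) ≤ p (t+1) * (b / (a+b)) + 2 * (a/b) *
      hsum (fun t z => Vf η (hlike μ θ Z t 1 z) (hlike μ θ Z t 2 z)) t 0 (fun _ => 1) := by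
  have := hC.prob
  have ha : 0 < a := by linarith
  have hs : (fun t z => Vf η (hlike μ θ Z t 2 z) (hlike μ θ Z t 1 z))
      = (fun t z => Vf η (hlike μ θ Z t 1 z) (hlike μ θ Z t 2 z)) := by
    funext t z
    exact Vf_comm _ _ _
  have b1 := cascade_bad hC hb hab h1 h2 1 2 t 0 (fun _ => 1)
  have b2 := cascade_bad hC hb hab h1 h2 2 1 t 0 (fun _ => 1)
  rw [hs] at b2
  have rev : ∀ i k, (i = 1 ∧ k = 2 ∨ i = 2 ∧ k = 1) →
      (μ {w | w ∈ {w | w ∈ {ω | Z (t+1) ω ≠ θ ω} ∧ I (t+1) w = 1} ∧ θ w = i}).toReal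
      = 1 / 2 * (p (t+1) * (b / (a+b))) := by
    intro i k hik
    have j := hC.joint i (by tauto) {t+1} (by simp) (fun _ => k) (fun _ => 1) (by simp; omega)
      (by simp)
    have e : {w | w ∈ {w | w ∈ {ω | Z (t+1) ω ≠ θ ω} ∧ I (t+1) w = 1} ∧ θ w = i}
        = {ω | θ ω = i ∧ ∀ s ∈ ({t+1} : Finset ℕ), X s ω = k ∧ I s ω = 1} := by
      ext w
      simp only [Set.mem_ofPred_eq, Finset.mem_singleton, forall_eq]
      have hx := hC.X_range (t+1) w
      constructor
      · rintro ⟨⟨g1, g2⟩, g3⟩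
        rw [hC.dynamics (t+1) (by omega), if_pos g2, g3] at g1
        exact ⟨g3, by omega, g2⟩
      · rintro ⟨g1, g2, g3⟩
        refine ⟨⟨?_, g3⟩, g1⟩
        rw [hC.dynamics (t+1) (by omega), if_pos g3, g1]
        omega
    rw [e, j]
    have : signalProb a b i k = b / (a+b) := by
      unfold signalProb
      rw [if_neg (by omega)]
    simp [this]
    ring
  have bay : ∀ i j, (i = 1 ∧ j = 2 ∨ i = 2 ∧ j = 1) →
      (μ {w | w ∈ {w | w ∈ {ω | Z (t+1) ω ≠ θ ω} ∧ I (t+1) w = 0} ∧ θ w = i}).toReal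
      ≤ (μ {ω | θ ω = i ∧ (∀ s ∈ Finset.Icc 1 0, Z s ω = 1) ∧
      b * hlike μ θ Z (0+t) i (fun s => Z s ω) ≤
        a * hlike μ θ Z (0+t) j (fun s => Z s ω)}).toReal := by
    intro i j hij
    apply ENNReal.toReal_mono (measure_ne_top _ _)
    apply measure_mono
    rintro ω ⟨⟨g1, g2⟩, g3⟩
    refine ⟨g3, by simp, ?_⟩
    by_contra hlt
    rw [not_le, zero_add] at hlt
    have g1' : Z (t+1) ω ≠ θ ω := g1
    rw [hC.dynamics (t+1) (by omega), g2, g3] at g1'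
    simp only [zero_ne_one, if_false] at g1'
    rcases hij with ⟨rfl, rfl⟩ | ⟨rfl, rfl⟩
    · exact g1' (cascade_map_one hC hb hab t _ hlt ω (fun _ _ => rfl))
    · exact g1' (cascade_map_two hC hb hab t _ hlt ω (fun _ _ => rfl))
  unfold errProb
  rw [split_two (hC.I_meas (t+1)) zero_ne_one (hC.I_range (t+1)),
    split_two hC.theta_meas (show (1:ℕ) ≠ 2 by norm_num) hC.theta_range {w | _ ∧ I (t+1) w = 0},
    split_two hC.theta_meas (show (1:ℕ) ≠ 2 by norm_num) hC.theta_range {w | _ ∧ I (t+1) w = 1},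
    rev 1 2 (by simp), rev 2 1 (by simp)]
  have y1 := (bay 1 2 (by simp)).trans b1
  have y2 := (bay 2 1 (by simp)).trans b2
  constructor
  · linarith [ENNReal.toReal_nonneg
      (a := μ {w | w ∈ {w | w ∈ {ω | Z (t+1) ω ≠ θ ω} ∧ I (t+1) w = 0} ∧ θ w = 1}),
      ENNReal.toReal_nonneg
      (a := μ {w | w ∈ {w | w ∈ {ω | Z (t+1) ω ≠ θ ω} ∧ I (t+1) w = 0} ∧ θ w = 2})]
  · linarith

theorem kappaStar_pos (hb : 0 < b) (hab : b < a) : 0 < kappaStar a b := by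
  obtain ⟨η, -, -, h, e, -⟩ := exists_eta hb hab
  rw [e]; positivity

theorem cascade_main (hb : 0 < b) (hab : b < a) {ε : ℝ} (hε : 0 < ε)
    (hp : ∀ t : ℕ, 1 ≤ t →
      p t = min ((1 + ε) * ((a + b) / b) * kappaStar a b / t) 1)
    (hC : IsCascade a b p μ θ X I Z) :
    Filter.Tendsto (fun t : ℕ => (t : ℝ) * errProb μ θ Z t) Filter.atTop
      (nhds ((1 + ε) * kappaStar a b)) := by
  have ha : 0 < a := by linarith
  obtain ⟨η, h1, h2, hf, hκ, hq⟩ := exists_eta hb hab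
  have hκ0 := kappaStar_pos hb hab
  set f := 1 + η * (a/b - 1) - (a/b) ^ η
  set q := ((a/b) ^ (1 - η) + (a/b) ^ η) * (b / (a+b))
  set S : ℕ → ℝ := fun n =>
    hsum (fun t z => Vf η (hlike μ θ Z t 1 z) (hlike μ θ Z t 2 z)) n 0 (fun _ => 1) with hSdef
  have hS0 : ∀ n, 0 ≤ S n := fun n => hsum_nonneg
    (fun t z => Vf_nonneg _ ENNReal.toReal_nonneg ENNReal.toReal_nonneg) n _ _
  have hSc : ∀ n, S (n+1) ≤ max (1 - p (n+1) * (b / (a+b)) * f) q * S n := by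
    intro n
    have := hsum_contract (F := fun t z => Vf η (hlike μ θ Z t 1 z) (hlike μ θ Z t 2 z))
      (q := fun n => max (1 - p n * (b / (a+b)) * f) q)
      (fun t z => cascade_contract hC hb hab h1 h2 t z) n 0 (fun _ => 1)
    simpa using this
  have lim0 : ∀ c : ℝ, Tendsto (fun n : ℕ => c / ((n:ℝ) + 1)) atTop (nhds 0) := by
    intro c
    exact Tendsto.div_atTop tendsto_const_nhds
      (tendsto_atTop_add_const_right _ _ tendsto_natCast_atTop_atTop)
  have hpe : ∀ᶠ n : ℕ in atTop, p (n+1) * (b / (a+b)) = (1 + ε) * kappaStar a b / ((n:ℝ) + 1) := by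
    filter_upwards [(lim0 ((1 + ε) * ((a + b) / b) * kappaStar a b)).eventually
      (ge_mem_nhds zero_lt_one)] with n hn
    rw [hp (n+1) (by omega), min_eq_left (by push_cast; exact hn)]
    push_cast
    field_simp
  have hSe : ∀ᶠ n : ℕ in atTop, S (n+1) ≤ (1 - (1 + ε) / ((n:ℝ) + 1)) * S n := by
    filter_upwards [hpe, (lim0 (1 + ε)).eventually (ge_mem_nhds (sub_pos.2 hq))] with n hn hn2
    refine (hSc n).trans (mul_le_mul_of_nonneg_right ?_ (hS0 n))
    apply max_le
    · rw [hn, hκ]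
      apply le_of_eq
      field_simp
    · linarith
  have dec := decay_aux hS0 hε hSe
  rw [← tendsto_add_atTop_iff_nat 1]
  have up : Tendsto (fun n : ℕ => (1 + ε) * kappaStar a b + 2 * (a/b) * (((n:ℝ) + 1) * S n)) atTop
      (nhds ((1 + ε) * kappaStar a b)) := by
    simpa using (dec.const_mul (2 * (a/b))).const_add ((1 + ε) * kappaStar a b)
  refine tendsto_of_tendsto_of_tendsto_of_le_of_le' tendsto_const_nhds up ?_ ?_
  · filter_upwards [hpe] with n hn
    have := (cascade_err hC hb hab h1 h2 n).1
    rw [hn, div_le_iff₀ (by positivity)] at this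
    push_cast
    linarith
  · filter_upwards [hpe] with n hn
    have := (cascade_err hC hb hab h1 h2 n).2
    rw [hn] at this
    have hn1 : (0:ℝ) < (n:ℝ) + 1 := by positivity
    push_cast
    calc ((n:ℝ) + 1) * errProb μ θ Z (n+1)
        ≤ ((n:ℝ) + 1) * ((1 + ε) * kappaStar a b / ((n:ℝ) + 1) + 2 * (a/b) * S n) := by gcongr
      _ = _ := by field_simp

end cascade

section construction

theorem mapEst_congr_Z {Ω : Type*} [MeasurableSpace Ω] (μ : Measure Ω) (θ : Ω → ℕ)
    (X Z Z' : ℕ → Ω → ℕ) (t : ℕ) (ω : Ω)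
    (h : ∀ s ∈ Finset.Icc 1 (t - 1), Z s = Z' s) :
    mapEst μ θ X Z t ω = mapEst μ θ X Z' t ω := by
  have hD : ∀ i, Dlike μ θ X Z t i ω = Dlike μ θ X Z' t i ω := by
    intro i
    unfold Dlike
    have : {w | θ w = i ∧ (∀ s ∈ Finset.Icc 1 (t - 1), Z s w = Z s ω) ∧ X t w = X t ω}
      = {w | θ w = i ∧ (∀ s ∈ Finset.Icc 1 (t - 1), Z' s w = Z' s ω) ∧ X t w = X t ω} := by
      ext w
      simp only [Set.mem_ofPred_eq]
      constructor
      · rintro ⟨h1, h2, h3⟩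
        exact ⟨h1, fun s hs => by rw [← h s hs]; exact h2 s hs, h3⟩
      · rintro ⟨h1, h2, h3⟩
        exact ⟨h1, fun s hs => by rw [h s hs]; exact h2 s hs, h3⟩
    rw [this]
  unfold mapEst
  rw [hD, hD]

/-- Table of the first `n` actions. -/
def actTable {Ω : Type*} [MeasurableSpace Ω] (μ : Measure Ω) (θ : Ω → ℕ)
    (X I : ℕ → Ω → ℕ) : ℕ → (ℕ → Ω → ℕ)
  | 0 => fun _ _ => 1
  | n + 1 => Function.update (actTable μ θ X I n) (n+1)
      (fun ω => if I (n+1) ω = 1 then X (n+1) ω else mapEst μ θ X (actTable μ θ X I n) (n+1) ω)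

/-- The actions generated by the dynamics. -/
def act {Ω : Type*} [MeasurableSpace Ω] (μ : Measure Ω) (θ : Ω → ℕ)
    (X I : ℕ → Ω → ℕ) (t : ℕ) : Ω → ℕ := actTable μ θ X I t t

theorem actTable_eq {Ω : Type*} [MeasurableSpace Ω] (μ : Measure Ω) (θ : Ω → ℕ)
    (X I : ℕ → Ω → ℕ) (n s : ℕ) (hs : s ≤ n) : actTable μ θ X I n s = act μ θ X I s := by
  induction n, hs using Nat.le_induction with
  | base => rfl
  | succ n hn ih =>
    rw [actTable, Function.update_of_ne (by omega), ih]

theorem act_dynamics {Ω : Type*} [MeasurableSpace Ω] (μ : Measure Ω) (θ : Ω → ℕ)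
    (X I : ℕ → Ω → ℕ) (t : ℕ) (ht : 1 ≤ t) (ω : Ω) :
    act μ θ X I t ω = if I t ω = 1 then X t ω else mapEst μ θ X (act μ θ X I) t ω := by
  obtain ⟨n, rfl⟩ : ∃ n, t = n + 1 := ⟨t - 1, by omega⟩
  rw [act, actTable, Function.update_self]
  rw [mapEst_congr_Z μ θ X (actTable μ θ X I n) (act μ θ X I)]
  intro s hs
  simp only [Finset.mem_Icc] at hs
  exact actTable_eq μ θ X I n s (by omega)

theorem act_measurable {Ω : Type*} [MeasurableSpace Ω] (μ : Measure Ω) (θ : Ω → ℕ)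
    (X I : ℕ → Ω → ℕ) (hX : ∀ t, Measurable (X t)) (hI : ∀ t, Measurable (I t)) (t : ℕ) :
    Measurable (act μ θ X I t) := by
  induction t using Nat.strong_induction_on with
  | _ t ih =>
    rcases Nat.eq_zero_or_pos t with rfl | ht
    · exact measurable_const
    · have hmap : Measurable (mapEst μ θ X (act μ θ X I) t) := by
        let T : Ω → (Finset.Icc 1 (t-1) → ℕ) × ℕ := fun ω => (fun s => act μ θ X I s ω, X t ω)
        have hT : Measurable T := by
          refine Measurable.prodMk (measurable_pi_lambda _ fun s => ih s ?_) (hX t)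
          have := Finset.mem_Icc.1 s.2
          omega
        have hf : Function.FactorsThrough (mapEst μ θ X (act μ θ X I) t) T := by
          intro ω ω' h
          simp only [T, Prod.mk.injEq] at h
          exact mapEst_congr μ θ X _ t ω ω' (fun s hs => congrFun h.1 ⟨s, hs⟩) h.2
        rw [← hf.extend_comp (fun _ => 0)]
        exact (Measurable.of_discrete).comp hT
      have : act μ θ X I t = fun ω =>
          if I t ω = 1 then X t ω else mapEst μ θ X (act μ θ X I) t ω :=
        funext (act_dynamics μ θ X I t ht)
      rw [this]
      exact Measurable.ite (hI t (measurableSet_singleton 1)) (hX t) hmap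

/-- Bernoulli measure on `Bool`. -/
def bern (r : ℝ) : Measure Bool :=
  ENNReal.ofReal (max 0 (min r 1)) • Measure.dirac true +
    ENNReal.ofReal (1 - max 0 (min r 1)) • Measure.dirac false

instance bern_prob (r : ℝ) : IsProbabilityMeasure (bern r) := by
  constructor
  have h1 : max 0 (min r 1) ≤ 1 := max_le zero_le_one (min_le_right _ _)
  simp only [bern, Measure.add_apply, Measure.smul_apply, measure_univ, smul_eq_mul, mul_one]
  rw [← ENNReal.ofReal_add (le_max_left _ _) (by linarith)]
  simp

theorem bern_apply {r : ℝ} (h0 : 0 ≤ r) (h1 : r ≤ 1) (d : Bool) :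
    (bern r {d}).toReal = if d = true then r else 1 - r := by
  have : max 0 (min r 1) = r := by rw [min_eq_left h1, max_eq_right h0]
  unfold bern
  rw [this]
  cases d <;> simp [h0, h1]

theorem exists_cascade {a b : ℝ} (hb : 0 < b) (hab : b < a) (p : ℕ → ℝ)
    (hp : ∀ t : ℕ, 1 ≤ t → p t ∈ Set.Icc (0:ℝ) 1) :
    ∃ (Ω' : Type) (m' : MeasurableSpace Ω') (μ' : @Measure Ω' m')
        (θ' : Ω' → ℕ) (X' I' Z' : ℕ → Ω' → ℕ),
        @IsCascade a b p Ω' m' μ' θ' X' I' Z' := by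
  have ha : 0 < a := by linarith
  let u : ℕ → ℝ := fun t => if t = 0 then 1/2 else b / (a+b)
  let μ' : Measure (ℕ → Bool × Bool) := Measure.infinitePi (fun t => (bern (u t)).prod (bern (p t)))
  let θ' : (ℕ → Bool × Bool) → ℕ := fun ω => if (ω 0).1 = true then 1 else 2
  let X' : ℕ → (ℕ → Bool × Bool) → ℕ := fun t ω => if (ω t).1 = true then 3 - θ' ω else θ' ω
  let I' : ℕ → (ℕ → Bool × Bool) → ℕ := fun t ω => if (ω t).2 = true then 1 else 0
  have hm1 : ∀ t, Measurable fun ω : ℕ → Bool × Bool => (ω t).1 := fun t =>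
    measurable_fst.comp (measurable_pi_apply t)
  have hm2 : ∀ t, Measurable fun ω : ℕ → Bool × Bool => (ω t).2 := fun t =>
    measurable_snd.comp (measurable_pi_apply t)
  have hθ : Measurable θ' :=
    (Measurable.of_discrete (f := fun d : Bool => if d = true then 1 else 2)).comp (hm1 0)
  have hX : ∀ t, Measurable (X' t) := fun t =>
    (Measurable.of_discrete (f := fun d : Bool × ℕ => if d.1 = true then 3 - d.2 else d.2)).comp
      ((hm1 t).prodMk hθ)
  have hI : ∀ t, Measurable (I' t) := fun t =>
    (Measurable.of_discrete (f := fun d : Bool => if d = true then 1 else 0)).comp (hm2 t)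
  have rθ : ∀ ω, θ' ω = 1 ∨ θ' ω = 2 := by
    intro ω; simp only [θ']; split_ifs <;> simp
  refine ⟨ℕ → Bool × Bool, inferInstance, μ', θ', X', I', act μ' θ' X' I', ?_⟩
  refine ⟨inferInstance, hθ, hX, hI, act_measurable μ' θ' X' I' hX hI, hp, rθ, ?_, ?_,
    fun _ => rfl, ?_, act_dynamics μ' θ' X' I'⟩
  · intro t ω
    have := rθ ω
    simp only [X']
    split_ifs <;> omega
  · intro t ω
    simp only [I']; split_ifs <;> simp
  · intro i hi s hs x c hx hc
    have h0 : 0 ∉ s := fun h => by simpa using hs 0 h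
    have e : {ω | θ' ω = i ∧ ∀ t ∈ s, X' t ω = x t ∧ I' t ω = c t}
        = Set.pi (insert 0 s : Finset ℕ) (fun t => if t = 0 then {decide (i = 1)} ×ˢ Set.univ
          else {decide (x t ≠ i)} ×ˢ {decide (c t = 1)}) := by
      ext ω
      simp only [Set.mem_ofPred_eq, Set.mem_pi, Finset.mem_coe, Finset.mem_insert, forall_eq_or_imp,
        if_true, Set.mem_prod, Set.mem_singleton_iff, Set.mem_univ, and_true]
      have hθi : θ' ω = i ↔ (ω 0).1 = decide (i = 1) := by
        simp only [θ']
        rcases hi with rfl | rfl <;> cases (ω 0).1 <;> simp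
      rw [← hθi]
      refine and_congr_right fun hi' => forall₂_congr fun t ht => ?_
      have ht0 : t ≠ 0 := fun h => h0 (h ▸ ht)
      simp only [if_neg ht0, Set.mem_prod, Set.mem_singleton_iff, X', I', hi']
      refine and_congr ?_ ?_
      · rcases hi with rfl | rfl <;> rcases hx t with h | h <;> rw [h] <;> cases (ω t).1 <;> simp
      · rcases hc t with h | h <;> rw [h] <;> cases (ω t).2 <;> simp
    rw [e, Measure.infinitePi_pi _ (fun t _ => MeasurableSet.of_discrete), ENNReal.toReal_prod,
      Finset.prod_insert h0]
    congr 1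
    · rw [if_pos rfl, Measure.prod_prod, measure_univ, mul_one, bern_apply]
      · simp only [u, if_true]
        split_ifs <;> norm_num
      · simp [u]
      · simp only [u, if_true]; norm_num
    · refine Finset.prod_congr rfl fun t ht => ?_
      have ht0 : t ≠ 0 := fun h => h0 (h ▸ ht)
      have hpt := hp t (hs t ht)
      have hb1 : b / (a+b) ≤ 1 := by rw [div_le_one (by linarith)]; linarith
      have hut : u t = b / (a+b) := by simp [u, ht0]
      rw [if_neg ht0, Measure.prod_prod, ENNReal.toReal_mul, hut, bern_apply (by positivity) hb1,
        bern_apply hpt.1 hpt.2]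
      congr 1
      · unfold signalProb
        by_cases h : x t = i
        · simp [h]; field_simp; ring
        · simp [h]
      · simp

theorem part_two {a b : ℝ} (hb : 0 < b) (hab : b < a) :
    sInf {x : ℝ≥0∞ |
      ∃ (p' : ℕ → ℝ) (Ω' : Type) (m' : MeasurableSpace Ω') (μ' : @Measure Ω' m')
        (θ' : Ω' → ℕ) (X' I' Z' : ℕ → Ω' → ℕ),
        @IsCascade a b p' Ω' m' μ' θ' X' I' Z' ∧
        x = Filter.limsup
              (fun t : ℕ => (t : ℝ≥0∞) * μ' {ω | Z' t ω ≠ θ' ω}) Filter.atTop}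
      ≤ ENNReal.ofReal (kappaStar a b) := by
  have ha : 0 < a := by linarith
  have hκ := kappaStar_pos hb hab
  have key : ∀ ε : ℝ, 0 < ε → sInf {x : ℝ≥0∞ |
      ∃ (p' : ℕ → ℝ) (Ω' : Type) (m' : MeasurableSpace Ω') (μ' : @Measure Ω' m')
        (θ' : Ω' → ℕ) (X' I' Z' : ℕ → Ω' → ℕ),
        @IsCascade a b p' Ω' m' μ' θ' X' I' Z' ∧
        x = Filter.limsup
              (fun t : ℕ => (t : ℝ≥0∞) * μ' {ω | Z' t ω ≠ θ' ω}) Filter.atTop}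
      ≤ ENNReal.ofReal ((1 + ε) * kappaStar a b) := by
    intro ε hε
    let p : ℕ → ℝ := fun t => min ((1 + ε) * ((a + b) / b) * kappaStar a b / t) 1
    obtain ⟨Ω', m', μ', θ', X', I', Z', hC⟩ := exists_cascade hb hab p
      (fun t _ => ⟨le_min (by positivity) zero_le_one, min_le_right _ _⟩)
    apply sInf_le
    refine ⟨p, Ω', m', μ', θ', X', I', Z', hC, ?_⟩
    have := hC.prob
    have lim := cascade_main hb hab hε (fun _ _ => rfl) hC
    have lim' := ENNReal.tendsto_ofReal lim
    have e : (fun t : ℕ => ENNReal.ofReal ((t:ℝ) * errProb μ' θ' Z' t))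
        = fun t : ℕ => (t : ℝ≥0∞) * μ' {ω | Z' t ω ≠ θ' ω} := by
      funext t
      rw [ENNReal.ofReal_mul (Nat.cast_nonneg t), ENNReal.ofReal_natCast, errProb,
        ENNReal.ofReal_toReal (measure_ne_top _ _)]
    rw [e] at lim'
    exact lim'.limsup_eq.symm
  have lim : Tendsto (fun ε : ℝ => ENNReal.ofReal ((1 + ε) * kappaStar a b)) (nhdsWithin 0 (Set.Ioi 0))
      (nhds (ENNReal.ofReal (kappaStar a b))) := by
    apply ENNReal.tendsto_ofReal
    have : Tendsto (fun ε : ℝ => (1 + ε) * kappaStar a b) (nhds 0) (nhds ((1 + 0) * kappaStar a b)) :=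
      Continuous.tendsto (by fun_prop) 0
    rw [add_zero, one_mul] at this
    exact this.mono_left nhdsWithin_le_nhds
  exact ge_of_tendsto lim (by filter_upwards [self_mem_nhdsWithin] with ε hε using key ε hε)

end construction

/-- If `p_t = min((1+ε)·((a+b)/b)·κ*(a,b)/t, 1)` for all `t ≥ 1`, then
`t·E_t → (1+ε)·κ*(a,b)`; in particular the infimum over all sequences of revealing
probabilities of `limsup_{t→∞} t·E_t` is at most `κ*(a,b)`. -/
theorem learning_rate_upper_bound (a b : ℝ) (hb : 0 < b) (hab : b < a)
    (ε : ℝ) (hε : 0 < ε) (p : ℕ → ℝ)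
    (hp : ∀ t : ℕ, 1 ≤ t →
      p t = min ((1 + ε) * ((a + b) / b) * kappaStar a b / t) 1)
    {Ω : Type*} [MeasurableSpace Ω] (μ : Measure Ω) (θ : Ω → ℕ)
    (X I Z : ℕ → Ω → ℕ) (hC : IsCascade a b p μ θ X I Z) :
    Filter.Tendsto (fun t : ℕ => (t : ℝ) * errProb μ θ Z t) Filter.atTop
      (nhds ((1 + ε) * kappaStar a b)) ∧
    sInf {x : ℝ≥0∞ |
      ∃ (p' : ℕ → ℝ) (Ω' : Type) (m' : MeasurableSpace Ω') (μ' : @Measure Ω' m')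
        (θ' : Ω' → ℕ) (X' I' Z' : ℕ → Ω' → ℕ),
        @IsCascade a b p' Ω' m' μ' θ' X' I' Z' ∧
        x = Filter.limsup
              (fun t : ℕ => (t : ℝ≥0∞) * μ' {ω | Z' t ω ≠ θ' ω}) Filter.atTop}
      ≤ ENNReal.ofReal (kappaStar a b) := by
  exact ⟨cascade_main hb hab hε hp hC, part_two hb hab⟩
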